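/- Fix 0 < q < 1. If x, y ∈ ℝ lie in the same orbit of the multiplicative action of q^ℤ, i.e. y = q^n·x for some integer n, then the spectral distance associated with the q-derivative satisfies d_{D_q}(x,y) = √q·|x − y|. -/

import Mathlib

open MeasureTheory Filter
open scoped ENNReal

noncomputable section

/-- The spectral distance on `ℝ` associated with the `q`-derivative: the supremum of
`f x − f y` over smooth functions `f` vanishing at infinity satisfying the norm condition
`‖[D_q, M_f]‖ ≤ 1`, i.e. `|f(t) − f(qt)| ≤ √q·(1−q)·|t|` for all `t`. -/
def qSpecDist (q : ℝ) (x y : ℝ) : ℝ≥0∞ :=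
  ⨆ f : {f : ℝ → ℝ // ContDiff ℝ (⊤ : ℕ∞) f ∧ Tendsto f (cocompact ℝ) (nhds 0) ∧
      ∀ t : ℝ, |f t - f (q * t)| ≤ Real.sqrt q * (1 - q) * |t|},
    ENNReal.ofReal (f.1 x - f.1 y)

/-- The norm condition telescopes along the orbit of `x` under multiplication by `q`. -/
theorem abs_sub_pow_mul_le {q c : ℝ} (hq0 : 0 < q) {f : ℝ → ℝ}
    (hf : ∀ t : ℝ, |f t - f (q * t)| ≤ c * (1 - q) * |t|) (n : ℕ) (x : ℝ) :
    |f x - f (q ^ n * x)| ≤ c * ((1 - q ^ n) * |x|) := by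
  induction n with
  | zero => simp
  | succ n ih =>
    have h := hf (q ^ n * x)
    rw [abs_mul, abs_of_pos (pow_pos hq0 n), ← mul_assoc, ← pow_succ'] at h
    calc |f x - f (q ^ (n + 1) * x)|
        ≤ |f x - f (q ^ n * x)| + |f (q ^ n * x) - f (q ^ (n + 1) * x)| := abs_sub_le _ _ _
      _ ≤ c * ((1 - q ^ n) * |x|) + c * (1 - q) * (q ^ n * |x|) := add_le_add ih h
      _ = c * ((1 - q ^ (n + 1)) * |x|) := by ring

theorem abs_sub_pow_mul_le_abs_sub {q c : ℝ} (hq0 : 0 < q) (hq1 : q < 1) {f : ℝ → ℝ}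
    (hf : ∀ t : ℝ, |f t - f (q * t)| ≤ c * (1 - q) * |t|) (n : ℕ) (x : ℝ) :
    |f x - f (q ^ n * x)| ≤ c * |x - q ^ n * x| := by
  have h : |x - q ^ n * x| = (1 - q ^ n) * |x| := by
    rw [← one_sub_mul, abs_mul, abs_of_nonneg (sub_nonneg.2 (pow_le_one₀ hq0.le hq1.le))]
  rw [h]
  exact abs_sub_pow_mul_le hq0 hf n x

theorem abs_sub_zpow_mul_le_abs_sub {q c : ℝ} (hq0 : 0 < q) (hq1 : q < 1) {f : ℝ → ℝ}
    (hf : ∀ t : ℝ, |f t - f (q * t)| ≤ c * (1 - q) * |t|) (n : ℤ) (x : ℝ) :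
    |f x - f (q ^ n * x)| ≤ c * |x - q ^ n * x| := by
  obtain ⟨m, rfl | rfl⟩ := n.eq_nat_or_neg
  · simpa using abs_sub_pow_mul_le_abs_sub hq0 hq1 hf m x
  · have h := abs_sub_pow_mul_le_abs_sub hq0 hq1 hf m (q ^ (-(m : ℤ)) * x)
    have hx : q ^ m * (q ^ (-(m : ℤ)) * x) = x := by
      rw [zpow_neg, zpow_natCast, mul_inv_cancel_left₀ (pow_ne_zero m hq0.ne')]
    rwa [hx, abs_sub_comm, abs_sub_comm _ x] at h

theorem contDiff_div_one_add_mul_sq {ε : ℝ} (hε : 0 < ε) :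
    ContDiff ℝ (⊤ : ℕ∞) fun t : ℝ => t / (1 + ε * t ^ 2) :=
  contDiff_id.div (by fun_prop) fun t => by positivity

theorem tendsto_div_one_add_mul_sq_cocompact {ε : ℝ} (hε : 0 < ε) :
    Tendsto (fun t : ℝ => t / (1 + ε * t ^ 2)) (cocompact ℝ) (nhds 0) := by
  have hlim : Tendsto (fun t : ℝ => ε⁻¹ * ‖t‖⁻¹) (cocompact ℝ) (nhds 0) := by
    simpa using
      (tendsto_inv_atTop_zero.comp (tendsto_norm_cocompact_atTop (E := ℝ))).const_mul ε⁻¹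
  refine squeeze_zero_norm (fun t => ?_) hlim
  rcases eq_or_ne t 0 with rfl | ht
  · simp
  · have hpos : 0 < |t| := abs_pos.2 ht
    rw [norm_div, Real.norm_eq_abs, Real.norm_eq_abs,
      abs_of_pos (by positivity : 0 < 1 + ε * t ^ 2), ← mul_inv,
      ← one_div, div_le_div_iff₀ (by positivity) (by positivity), ← sq_abs t]
    nlinarith

/-- The function `t ↦ t / (1 + ε t²)` is `1`-Lipschitz. -/
theorem abs_div_one_add_mul_sq_sub_le {ε : ℝ} (hε : 0 < ε) (s t : ℝ) :
    |t / (1 + ε * t ^ 2) - s / (1 + ε * s ^ 2)| ≤ |t - s| := by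
  have heq : t / (1 + ε * t ^ 2) - s / (1 + ε * s ^ 2) =
      (t - s) * ((1 - ε * t * s) / ((1 + ε * t ^ 2) * (1 + ε * s ^ 2))) := by
    have ht : 1 + ε * t ^ 2 ≠ 0 := by positivity
    have hs : 1 + ε * s ^ 2 ≠ 0 := by positivity
    field_simp
    ring
  rw [heq, abs_mul]
  refine mul_le_of_le_one_right (abs_nonneg _) ?_
  rw [abs_div, abs_of_pos (by positivity : 0 < (1 + ε * t ^ 2) * (1 + ε * s ^ 2)),
    div_le_one (by positivity), abs_le]
  have hsum : 0 ≤ ε * (t + s) ^ 2 := by positivity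
  have hdiff : 0 ≤ ε * (t - s) ^ 2 := by positivity
  have hprod : 0 ≤ (ε * t * s) ^ 2 := by positivity
  have ht : 0 ≤ ε * t ^ 2 := by positivity
  have hs : 0 ≤ ε * s ^ 2 := by positivity
  constructor <;> nlinarith

/-- Rescaled functions `t ↦ t / (1 + ε t²)` are admissible in the definition of `qSpecDist`. -/
theorem ofReal_le_qSpecDist {q : ℝ} (hq1 : q < 1) {σ : ℝ} (hσ : |σ| = 1) {ε : ℝ} (hε : 0 < ε)
    (x y : ℝ) :
    ENNReal.ofReal (√q * σ * (x / (1 + ε * x ^ 2)) - √q * σ * (y / (1 + ε * y ^ 2))) ≤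
      qSpecDist q x y := by
  refine le_iSup_of_le ⟨fun t => √q * σ * (t / (1 + ε * t ^ 2)),
    contDiff_const.mul (contDiff_div_one_add_mul_sq hε), ?_, fun t => ?_⟩ le_rfl
  · simpa using (tendsto_div_one_add_mul_sq_cocompact hε).const_mul (√q * σ)
  · rw [← mul_sub, abs_mul, abs_mul, hσ, mul_one, abs_of_nonneg (Real.sqrt_nonneg q), mul_assoc]
    refine mul_le_mul_of_nonneg_left ?_ (Real.sqrt_nonneg q)
    calc _ ≤ |t - q * t| := abs_div_one_add_mul_sq_sub_le hε _ _
      _ = (1 - q) * |t| := by rw [← one_sub_mul, abs_mul, abs_of_pos (sub_pos.2 hq1)]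

theorem ofReal_sqrt_mul_abs_sub_le_qSpecDist {q : ℝ} (hq1 : q < 1) (x y : ℝ) :
    ENNReal.ofReal (√q * |x - y|) ≤ qSpecDist q x y := by
  obtain ⟨σ, hσ, hxy⟩ : ∃ σ : ℝ, |σ| = 1 ∧ σ * (x - y) = |x - y| := by
    rcases abs_choice (x - y) with h | h
    · exact ⟨1, by simp, by rw [h, one_mul]⟩
    · exact ⟨-1, by simp, by rw [h, neg_one_mul]⟩
  have hcont : ContinuousAt (fun ε : ℝ =>
      √q * σ * (x / (1 + ε * x ^ 2)) - √q * σ * (y / (1 + ε * y ^ 2))) 0 := by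
    fun_prop (disch := simp)
  have hlim := hcont.tendsto
  have hval : √q * σ * (x / (1 + 0 * x ^ 2)) - √q * σ * (y / (1 + 0 * y ^ 2)) =
      √q * |x - y| := by
    rw [← hxy]
    ring
  rw [hval] at hlim
  refine le_of_tendsto (ENNReal.tendsto_ofReal (hlim.mono_left nhdsWithin_le_nhds))
    (eventually_mem_nhdsWithin.mono fun ε (hε : ε ∈ Set.Ioi (0 : ℝ)) =>
      ofReal_le_qSpecDist hq1 hσ hε x y)

/-- For `0 < q < 1`, if `x` and `y` are in the same orbit of the multiplicative action of
`q^ℤ`, i.e. `y = qⁿ·x` for some integer `n`, then the spectral distance associated with the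
`q`-derivative equals `√q·|x − y|`. -/
theorem qSpecDist_eq_of_same_orbit {q : ℝ} (hq0 : 0 < q) (hq1 : q < 1) {x y : ℝ}
    (horbit : ∃ n : ℤ, y = q ^ n * x) :
    qSpecDist q x y = ENNReal.ofReal (Real.sqrt q * |x - y|) := by
  refine le_antisymm (iSup_le fun f => ENNReal.ofReal_le_ofReal ?_)
    (ofReal_sqrt_mul_abs_sub_le_qSpecDist hq1 x y)
  obtain ⟨n, rfl⟩ := horbit
  exact (le_abs_self _).trans (abs_sub_zpow_mul_le_abs_sub hq0 hq1 f.2.2.2 n x)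

end
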